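/- (Corollary 3.4, Weingarten relation) At every point (u,v), the partial derivatives of the unit normal of the inverse patch satisfy (U_y)_u = Φ_*((2η/r²) x_u − λ⁻¹ (U_x)_u) and (U_y)_v = Φ_*((2η/r²) x_v − λ⁻¹ (U_x)_v), where Φ_* denotes the tangent map of the inversion at x(u,v), given by Φ_*(w) = (r²/‖x − c‖²) w − (2r²⟨x − c, w⟩/‖x − c‖⁴)(x − c). In other words, the shape operators satisfy S̃ ∘ Φ_* = Φ_* ∘ (−λ⁻¹ S − (2η/r²) Id) on the coordinate vector fields. -/

import Mathlib

noncomputable section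
open scoped RealInnerProductSpace

/-- ℝ³ as Euclidean 3-space. -/
abbrev E3 : Type := EuclideanSpace ℝ (Fin 3)

/-- The cross product on ℝ³. -/
def cross (a b : E3) : E3 :=
  (WithLp.equiv 2 (Fin 3 → ℝ)).symm
    ![a 1 * b 2 - a 2 * b 1, a 2 * b 0 - a 0 * b 2, a 0 * b 1 - a 1 * b 0]

/-- The inversion of ℝ³ with center `c` and radius `r`. -/
def inv3 (c : E3) (r : ℝ) (p : E3) : E3 :=
  c + (r ^ 2 / ‖p - c‖ ^ 2) • (p - c)

/-- Partial derivative in the first variable. -/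
def pu {E : Type*} [NormedAddCommGroup E] [NormedSpace ℝ E]
    (x : ℝ → ℝ → E) (u v : ℝ) : E :=
  deriv (fun t => x t v) u

/-- Partial derivative in the second variable. -/
def pv {E : Type*} [NormedAddCommGroup E] [NormedSpace ℝ E]
    (x : ℝ → ℝ → E) (u v : ℝ) : E :=
  deriv (fun t => x u t) v

/-- The unit normal of a patch. -/
def unormal (x : ℝ → ℝ → E3) (u v : ℝ) : E3 :=
  ‖cross (pu x u v) (pv x u v)‖⁻¹ • cross (pu x u v) (pv x u v)

/-- The conformal factor λ of the inversion along the patch. -/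
def lam (c : E3) (r : ℝ) (x : ℝ → ℝ → E3) (u v : ℝ) : ℝ :=
  r ^ 2 / ‖x u v - c‖ ^ 2

/-- The support-type function η = ⟨U_x, x − c⟩. -/
def eta (c : E3) (x : ℝ → ℝ → E3) (u v : ℝ) : ℝ :=
  ⟪unormal x u v, x u v - c⟫

/-- First fundamental form coefficient E. -/
def FFE (x : ℝ → ℝ → E3) (u v : ℝ) : ℝ := ⟪pu x u v, pu x u v⟫
/-- First fundamental form coefficient F. -/
def FFF (x : ℝ → ℝ → E3) (u v : ℝ) : ℝ := ⟪pu x u v, pv x u v⟫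
/-- First fundamental form coefficient G. -/
def FFG (x : ℝ → ℝ → E3) (u v : ℝ) : ℝ := ⟪pv x u v, pv x u v⟫
/-- Second fundamental form coefficient e. -/
def SFe (x : ℝ → ℝ → E3) (u v : ℝ) : ℝ := ⟪pu (pu x) u v, unormal x u v⟫
/-- Second fundamental form coefficient f. -/
def SFf (x : ℝ → ℝ → E3) (u v : ℝ) : ℝ := ⟪pv (pu x) u v, unormal x u v⟫
/-- Second fundamental form coefficient g. -/
def SFg (x : ℝ → ℝ → E3) (u v : ℝ) : ℝ := ⟪pv (pv x) u v, unormal x u v⟫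
/-- Third fundamental form coefficient P. -/
def TFP (x : ℝ → ℝ → E3) (u v : ℝ) : ℝ := ⟪pu (unormal x) u v, pu (unormal x) u v⟫
/-- Third fundamental form coefficient Q. -/
def TFQ (x : ℝ → ℝ → E3) (u v : ℝ) : ℝ := ⟪pu (unormal x) u v, pv (unormal x) u v⟫
/-- Third fundamental form coefficient R. -/
def TFR (x : ℝ → ℝ → E3) (u v : ℝ) : ℝ := ⟪pv (unormal x) u v, pv (unormal x) u v⟫

/-- Christoffel symbol Γ¹₁₁. -/
def Ch111 (x : ℝ → ℝ → E3) (u v : ℝ) : ℝ :=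
  (FFG x u v * pu (FFE x) u v - 2 * FFF x u v * pu (FFF x) u v + FFF x u v * pv (FFE x) u v) /
    (2 * (FFE x u v * FFG x u v - FFF x u v ^ 2))
/-- Christoffel symbol Γ²₁₁. -/
def Ch211 (x : ℝ → ℝ → E3) (u v : ℝ) : ℝ :=
  (2 * FFE x u v * pu (FFF x) u v - FFE x u v * pv (FFE x) u v - FFF x u v * pu (FFE x) u v) /
    (2 * (FFE x u v * FFG x u v - FFF x u v ^ 2))
/-- Christoffel symbol Γ¹₁₂. -/
def Ch112 (x : ℝ → ℝ → E3) (u v : ℝ) : ℝ :=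
  (FFG x u v * pv (FFE x) u v - FFF x u v * pu (FFG x) u v) /
    (2 * (FFE x u v * FFG x u v - FFF x u v ^ 2))
/-- Christoffel symbol Γ²₁₂. -/
def Ch212 (x : ℝ → ℝ → E3) (u v : ℝ) : ℝ :=
  (FFE x u v * pu (FFG x) u v - FFF x u v * pv (FFE x) u v) /
    (2 * (FFE x u v * FFG x u v - FFF x u v ^ 2))
/-- Christoffel symbol Γ¹₂₂. -/
def Ch122 (x : ℝ → ℝ → E3) (u v : ℝ) : ℝ :=
  (2 * FFG x u v * pv (FFF x) u v - FFG x u v * pu (FFG x) u v - FFF x u v * pv (FFG x) u v) /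
    (2 * (FFE x u v * FFG x u v - FFF x u v ^ 2))
/-- Christoffel symbol Γ²₂₂. -/
def Ch222 (x : ℝ → ℝ → E3) (u v : ℝ) : ℝ :=
  (FFE x u v * pv (FFG x) u v - 2 * FFF x u v * pv (FFF x) u v + FFF x u v * pu (FFG x) u v) /
    (2 * (FFE x u v * FFG x u v - FFF x u v ^ 2))

/-- The tangent map of the inversion at `p`. -/
def phiStar (c : E3) (r : ℝ) (p : E3) (w : E3) : E3 :=
  (r ^ 2 / ‖p - c‖ ^ 2) • w - (2 * r ^ 2 * ⟪p - c, w⟫ / ‖p - c‖ ^ 4) • (p - c)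

lemma inner_eq_coord (a b : E3) : ⟪a, b⟫ = a 0 * b 0 + a 1 * b 1 + a 2 * b 2 := by
  simp [PiLp.inner_apply, Fin.sum_univ_three]
  ring

lemma norm_sq_eq_coord (a : E3) : ‖a‖ ^ 2 = a 0 ^ 2 + a 1 ^ 2 + a 2 ^ 2 := by
  simp [EuclideanSpace.real_norm_sq_eq, Fin.sum_univ_three]

lemma inner_cross_left (a b : E3) : ⟪cross a b, a⟫ = 0 := by
  simp only [inner_eq_coord, cross, WithLp.equiv_symm_apply, Matrix.cons_val]
  ring

lemma inner_cross_right (a b : E3) : ⟪cross a b, b⟫ = 0 := by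
  simp only [inner_eq_coord, cross, WithLp.equiv_symm_apply, Matrix.cons_val]
  ring

lemma norm_phiStar {c p : E3} {r : ℝ} (hp : p ≠ c) (w : E3) :
    ‖phiStar c r p w‖ = r ^ 2 / ‖p - c‖ ^ 2 * ‖w‖ := by
  have hN : ‖p - c‖ ≠ 0 := norm_ne_zero_iff.2 (sub_ne_zero.2 hp)
  rw [← sq_eq_sq₀ (norm_nonneg _) (by positivity), phiStar, norm_sub_sq_real]
  simp only [norm_smul, mul_pow, inner_smul_left, inner_smul_right, Real.norm_eq_abs, sq_abs,
    real_inner_comm (p - c) w, RCLike.conj_to_real]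
  field_simp
  ring

/-- The inversion reverses orientation, so its tangent map anticommutes with the cross product
up to the conformal factor. -/
lemma cross_phiStar {c p : E3} {r : ℝ} (hp : p ≠ c) (a b : E3) :
    cross (phiStar c r p a) (phiStar c r p b) =
      -((r ^ 2 / ‖p - c‖ ^ 2) • phiStar c r p (cross a b)) := by
  have hN : ‖p - c‖ ^ 2 ≠ 0 := pow_ne_zero 2 (norm_ne_zero_iff.2 (sub_ne_zero.2 hp))
  have h4 : ‖p - c‖ ^ 4 = (‖p - c‖ ^ 2) ^ 2 := by ring
  unfold phiStar
  rw [h4]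
  have hm := inv_mul_cancel₀ hN
  generalize p - c = d at *
  rw [norm_sq_eq_coord] at hm hN ⊢
  simp only [div_eq_mul_inv, ← inv_pow]
  generalize (d 0 ^ 2 + d 1 ^ 2 + d 2 ^ 2)⁻¹ = m at hm ⊢
  ext i
  fin_cases i <;>
  simp only [inner_eq_coord, cross, WithLp.equiv_symm_apply, Matrix.cons_val, PiLp.sub_apply,
    PiLp.smul_apply, PiLp.neg_apply, smul_eq_mul, Fin.zero_eta, Fin.mk_one, Fin.reduceFinMk]
  · linear_combination (-2 * r ^ 4 * m ^ 2 * (a 1 * b 2 - a 2 * b 1)) * hm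
  · linear_combination (-2 * r ^ 4 * m ^ 2 * (a 2 * b 0 - a 0 * b 2)) * hm
  · linear_combination (-2 * r ^ 4 * m ^ 2 * (a 0 * b 1 - a 1 * b 0)) * hm

lemma hasDerivAt_div_norm_sq {c : E3} {h : ℝ → ℝ} {k' : ℝ} {g : ℝ → E3} {g' : E3} {t : ℝ}
    (hh : HasDerivAt h k' t) (hg : HasDerivAt g g' t) (hc : g t ≠ c) :
    HasDerivAt (fun s => (h s / ‖g s - c‖ ^ 2) • (g s - c))
      ((h t / ‖g t - c‖ ^ 2) • g' +
        (k' / ‖g t - c‖ ^ 2 - 2 * h t * ⟪g t - c, g'⟫ / ‖g t - c‖ ^ 4) • (g t - c)) t := by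
  have hN : ‖g t - c‖ ≠ 0 := norm_ne_zero_iff.2 (sub_ne_zero.2 hc)
  have hd := hg.sub_const c
  refine ((hh.div hd.norm_sq (pow_ne_zero 2 hN)).smul hd).congr_deriv ?_
  simp only [Pi.div_apply]
  match_scalars <;> field_simp

lemma HasDerivAt.inv3 {c : E3} (r : ℝ) {g : ℝ → E3} {g' : E3} {t : ℝ}
    (hg : HasDerivAt g g' t) (hc : g t ≠ c) :
    HasDerivAt (fun s => inv3 c r (g s)) (phiStar c r (g t) g') t := by
  refine ((hasDerivAt_div_norm_sq (hasDerivAt_const t (r ^ 2)) hg hc).const_add c).congr_deriv ?_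
  rw [phiStar]
  module

/-- The normal field of the inverse patch along a curve, differentiated. -/
lemma hasDerivAt_reflected_normal {c : E3} {r : ℝ} (hr : r ≠ 0) {U g : ℝ → E3} {U' g' : E3}
    {t : ℝ} (hU : HasDerivAt U U' t) (hg : HasDerivAt g g' t) (hc : g t ≠ c)
    (horth : ⟪U t, g'⟫ = 0) :
    HasDerivAt (fun s => (2 * ⟪U s, g s - c⟫ / ‖g s - c‖ ^ 2) • (g s - c) - U s)
      (phiStar c r (g t) ((2 * ⟪U t, g t - c⟫ / r ^ 2) • g' -
        (r ^ 2 / ‖g t - c‖ ^ 2)⁻¹ • U')) t := by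
  have hN : ‖g t - c‖ ≠ 0 := norm_ne_zero_iff.2 (sub_ne_zero.2 hc)
  have hη := (hU.inner ℝ (hg.sub_const c)).const_mul 2
  rw [horth, zero_add] at hη
  refine ((hasDerivAt_div_norm_sq hη hg hc).sub hU).congr_deriv ?_
  simp only [phiStar, inner_sub_right, inner_smul_right, real_inner_comm (g t - c) U']
  match_scalars <;> field_simp <;> ring

lemma hasDerivAt_pu {x : ℝ → ℝ → E3} (hx : Differentiable ℝ (fun p : ℝ × ℝ => x p.1 p.2))
    (u v : ℝ) : HasDerivAt (fun t => x t v) (pu x u v) u :=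
  (hx.comp (differentiable_id.prodMk (differentiable_const v)) u).hasDerivAt

lemma hasDerivAt_pv {x : ℝ → ℝ → E3} (hx : Differentiable ℝ (fun p : ℝ × ℝ => x p.1 p.2))
    (u v : ℝ) : HasDerivAt (fun t => x u t) (pv x u v) v :=
  (hx.comp ((differentiable_const u).prodMk differentiable_id) v).hasDerivAt

lemma pu_eq_fderiv {x : ℝ → ℝ → E3} (hx : Differentiable ℝ (fun p : ℝ × ℝ => x p.1 p.2))
    (u v : ℝ) : pu x u v = fderiv ℝ (fun p : ℝ × ℝ => x p.1 p.2) (u, v) (1, 0) :=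
  ((hx (u, v)).hasFDerivAt.comp_hasDerivAt (f := fun t => (t, v)) u
    ((hasDerivAt_id u).prodMk (hasDerivAt_const u v))).deriv

lemma pv_eq_fderiv {x : ℝ → ℝ → E3} (hx : Differentiable ℝ (fun p : ℝ × ℝ => x p.1 p.2))
    (u v : ℝ) : pv x u v = fderiv ℝ (fun p : ℝ × ℝ => x p.1 p.2) (u, v) (0, 1) :=
  ((hx (u, v)).hasFDerivAt.comp_hasDerivAt (f := fun t => (u, t)) v
    ((hasDerivAt_const v u).prodMk (hasDerivAt_id v))).deriv

lemma Differentiable.cross {E : Type*} [NormedAddCommGroup E] [NormedSpace ℝ E] {a b : E → E3}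
    (ha : Differentiable ℝ a) (hb : Differentiable ℝ b) :
    Differentiable ℝ (fun p => cross (a p) (b p)) := by
  rw [differentiable_euclidean] at ha hb ⊢
  intro i
  fin_cases i
  · exact ((ha 1).mul (hb 2)).sub ((ha 2).mul (hb 1))
  · exact ((ha 2).mul (hb 0)).sub ((ha 0).mul (hb 2))
  · exact ((ha 0).mul (hb 1)).sub ((ha 1).mul (hb 0))

lemma differentiable_unormal {x : ℝ → ℝ → E3}
    (hx : ContDiff ℝ 2 (fun p : ℝ × ℝ => x p.1 p.2))
    (hreg : ∀ u v : ℝ, cross (pu x u v) (pv x u v) ≠ 0) :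
    Differentiable ℝ (fun p : ℝ × ℝ => unormal x p.1 p.2) := by
  have hd := hx.differentiable two_ne_zero
  have hf : Differentiable ℝ (fderiv ℝ (fun p : ℝ × ℝ => x p.1 p.2)) :=
    (hx.fderiv_right (m := 1) (by norm_num)).differentiable one_ne_zero
  have hn : Differentiable ℝ (fun p : ℝ × ℝ => cross (pu x p.1 p.2) (pv x p.1 p.2)) := by
    simp only [pu_eq_fderiv hd, pv_eq_fderiv hd]
    exact (hf.clm_apply (differentiable_const _)).cross (hf.clm_apply (differentiable_const _))
  intro p
  exact (((hn p).norm ℝ (hreg _ _)).inv (norm_ne_zero_iff.2 (hreg _ _))).smul (hn p)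

lemma unormal_inv3 {c : E3} {r : ℝ} (hr : r ≠ 0) {x : ℝ → ℝ → E3}
    (hx : Differentiable ℝ (fun p : ℝ × ℝ => x p.1 p.2)) {u v : ℝ} (hxc : x u v ≠ c) :
    unormal (fun u v => inv3 c r (x u v)) u v =
      (2 * ⟪unormal x u v, x u v - c⟫ / ‖x u v - c‖ ^ 2) • (x u v - c) - unormal x u v := by
  have hN : ‖x u v - c‖ ≠ 0 := norm_ne_zero_iff.2 (sub_ne_zero.2 hxc)
  have h1 : pu (fun u v => inv3 c r (x u v)) u v = phiStar c r (x u v) (pu x u v) :=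
    ((hasDerivAt_pu hx u v).inv3 r hxc).deriv
  have h2 : pv (fun u v => inv3 c r (x u v)) u v = phiStar c r (x u v) (pv x u v) :=
    ((hasDerivAt_pv hx u v).inv3 r hxc).deriv
  rw [unormal, h1, h2, cross_phiStar hxc, norm_neg, norm_smul, norm_phiStar hxc, unormal,
    Real.norm_of_nonneg (by positivity), phiStar]
  simp only [real_inner_smul_right, real_inner_comm (x u v - c)]
  match_scalars <;> field_simp

theorem inverse_patch_shape_operator
    (c : E3) (r : ℝ) (hr : 0 < r)
    (x : ℝ → ℝ → E3)
    (hx : ContDiff ℝ (⊤ : ℕ∞) (fun p : ℝ × ℝ => x p.1 p.2))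
    (hxc : ∀ u v : ℝ, x u v ≠ c)
    (y : ℝ → ℝ → E3) (hy : ∀ u v : ℝ, y u v = inv3 c r (x u v))
    (hreg : ∀ u v : ℝ, cross (pu x u v) (pv x u v) ≠ 0) :
    ∀ u v : ℝ,
      pu (unormal y) u v =
        phiStar c r (x u v)
          ((2 * eta c x u v / r ^ 2) • pu x u v - (lam c r x u v)⁻¹ • pu (unormal x) u v) ∧
      pv (unormal y) u v =
        phiStar c r (x u v)
          ((2 * eta c x u v / r ^ 2) • pv x u v - (lam c r x u v)⁻¹ • pv (unormal x) u v) := by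
  have hd : Differentiable ℝ (fun p : ℝ × ℝ => x p.1 p.2) := hx.differentiable (by simp)
  have hU := differentiable_unormal (hx.of_le (WithTop.coe_le_coe.2 le_top)) hreg
  obtain rfl : y = fun u v => inv3 c r (x u v) := funext₂ hy
  intro u v
  have hUy := fun u v => unormal_inv3 hr.ne' hd (hxc u v)
  constructor
  · rw [pu, funext fun t => hUy t v]
    refine (hasDerivAt_reflected_normal hr.ne' (hasDerivAt_pu hU u v) (hasDerivAt_pu hd u v)
      (hxc u v) ?_).deriv
    rw [unormal, real_inner_smul_left, inner_cross_left, mul_zero]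
  · rw [pv, funext fun t => hUy u t]
    refine (hasDerivAt_reflected_normal hr.ne' (hasDerivAt_pv hU u v) (hasDerivAt_pv hd u v)
      (hxc u v) ?_).deriv
    rw [unormal, real_inner_smul_left, inner_cross_right, mul_zero]
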